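/- For all ν > 1 and x > 0, I_ν(x) K_ν(x) ≥ 1/(2ν) - x² / (4ν(ν² - 1)). -/

import Mathlib

open Real MeasureTheory Set Filter

/-- Modified Bessel function of the first kind `I_ν`. -/
noncomputable def besselI (ν x : ℝ) : ℝ :=
  ∑' n : ℕ, (x / 2) ^ (2 * (n : ℝ) + ν) / ((n.factorial : ℝ) * Real.Gamma ((n : ℝ) + ν + 1))

/-- Modified Bessel function of the second kind `K_ν`. -/
noncomputable def besselK (ν x : ℝ) : ℝ :=
  ∫ t in Ioi (0 : ℝ), Real.exp (-x * Real.cosh t) * Real.cosh (ν * t)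

/-- Bessel function of the first kind `J_ν`. -/
noncomputable def besselJ (ν x : ℝ) : ℝ :=
  ∑' n : ℕ, (-1 : ℝ) ^ n * (x / 2) ^ (2 * (n : ℝ) + ν) /
    ((n.factorial : ℝ) * Real.Gamma ((n : ℝ) + ν + 1))

/-- Modified Struve function of the first kind `L_ν`. -/
noncomputable def struveL (ν x : ℝ) : ℝ :=
  ∑' n : ℕ, (x / 2) ^ (2 * (n : ℝ) + ν + 1) /
    (Real.Gamma ((n : ℝ) + 3 / 2) * Real.Gamma ((n : ℝ) + ν + 3 / 2))

/-- Airy function `Ai`. -/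
noncomputable def airyAi (t : ℝ) : ℝ :=
  (1 / Real.pi) * ∫ s in Ioi (0 : ℝ), Real.cos (s ^ 3 / 3 + s * t)

/-- Landau constant `b_L = 2^{1/3} ⬝ sup_{t ≥ 0} Ai(t)`. -/
noncomputable def landau_bL : ℝ :=
  (2 : ℝ) ^ ((1 : ℝ) / 3) * sSup (airyAi '' Ici 0)

/-- Landau constant `c_L = sup_{t ≥ 0} t^{1/3} J₀(t)`. -/
noncomputable def landau_cL : ℝ :=
  sSup ((fun t : ℝ => t ^ ((1 : ℝ) / 3) * besselJ 0 t) '' Ici 0)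

open scoped Topology

theorem Real.Gamma_le_Gamma_nat_add {s : ℝ} (hs : 1 ≤ s) (n : ℕ) :
    Real.Gamma s ≤ Real.Gamma (n + s) := by
  induction n with
  | zero => simp
  | succ n ih =>
    have hn : (1 : ℝ) ≤ n + s := by
      have : (0 : ℝ) ≤ n := n.cast_nonneg
      linarith
    have hstep : Real.Gamma (((n + 1 : ℕ) : ℝ) + s) = (n + s) * Real.Gamma (n + s) := by
      rw [← Real.Gamma_add_one (by linarith)]
      congr 1
      push_cast
      ring
    have hpos : 0 < Real.Gamma (n + s) := Real.Gamma_pos_of_pos (by linarith)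
    nlinarith

theorem besselI_term_nonneg {ν x : ℝ} (hν : 0 ≤ ν) (hx : 0 ≤ x) (n : ℕ) :
    0 ≤ (x / 2) ^ (2 * (n : ℝ) + ν) / ((n.factorial : ℝ) * Real.Gamma ((n : ℝ) + ν + 1)) := by
  have : 0 < Real.Gamma ((n : ℝ) + ν + 1) := Real.Gamma_pos_of_pos (by positivity)
  positivity

theorem summable_besselI_term {ν x : ℝ} (hν : 0 ≤ ν) (hx : 0 < x) :
    Summable fun n : ℕ ↦
      (x / 2) ^ (2 * (n : ℝ) + ν) / ((n.factorial : ℝ) * Real.Gamma ((n : ℝ) + ν + 1)) := by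
  refine Summable.of_nonneg_of_le (besselI_term_nonneg hν hx.le) (fun n ↦ ?_)
    ((Real.summable_pow_div_factorial ((x / 2) ^ 2)).mul_left
      ((x / 2) ^ ν / Real.Gamma (ν + 1)))
  have hΓ : 0 < Real.Gamma (ν + 1) := Real.Gamma_pos_of_pos (by positivity)
  have hle : Real.Gamma (ν + 1) ≤ Real.Gamma ((n : ℝ) + ν + 1) := by
    rw [add_assoc]
    exact Real.Gamma_le_Gamma_nat_add (by linarith) n
  have hpow : (x / 2) ^ (2 * (n : ℝ) + ν) = (x / 2) ^ ν * ((x / 2) ^ 2) ^ n := by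
    rw [Real.rpow_add (by positivity), mul_comm, ← pow_mul]
    congr 1
    exact_mod_cast Real.rpow_natCast (x / 2) (2 * n)
  calc _ ≤ (x / 2) ^ (2 * (n : ℝ) + ν) / ((n.factorial : ℝ) * Real.Gamma (ν + 1)) := by gcongr
    _ = _ := by rw [hpow]; field_simp

theorem besselI_nonneg {ν x : ℝ} (hν : 0 ≤ ν) (hx : 0 ≤ x) : 0 ≤ besselI ν x :=
  tsum_nonneg (besselI_term_nonneg hν hx)

theorem rpow_div_Gamma_le_besselI {ν x : ℝ} (hν : 0 ≤ ν) (hx : 0 < x) :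
    (x / 2) ^ ν / Real.Gamma (ν + 1) ≤ besselI ν x := by
  simpa [besselI] using
    (summable_besselI_term hν hx).le_tsum 0 fun n _ ↦ besselI_term_nonneg hν hx.le n

theorem besselI_recurrence {ν x : ℝ} (hν : 0 ≤ ν) (hx : 0 < x) :
    besselI ν x = 2 * (ν + 1) / x * besselI (ν + 1) x + besselI (ν + 2) x := by
  have hx2 : 0 < x / 2 := by positivity
  have h0 := summable_besselI_term hν hx
  have h1 := summable_besselI_term (ν := ν + 1) (by positivity) hx
  unfold besselI
  rw [h0.tsum_eq_zero_add, h1.tsum_eq_zero_add, mul_add, ← tsum_mul_left,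
    add_assoc (2 * (ν + 1) / x * _), ← Summable.tsum_add (((summable_nat_add_iff 1).2 h1).mul_left _)
      (summable_besselI_term (by positivity) hx)]
  congr 1
  · have hΓ : Real.Gamma (ν + 1) ≠ 0 := (Real.Gamma_pos_of_pos (by positivity)).ne'
    have hΓs : Real.Gamma (ν + 1 + 1) = (ν + 1) * Real.Gamma (ν + 1) :=
      Real.Gamma_add_one (by positivity)
    have hν1 : ν + 1 ≠ 0 := by positivity
    simp only [Nat.cast_zero, mul_zero, zero_add, Nat.factorial_zero, Nat.cast_one, one_mul]
    rw [Real.rpow_add_one hx2.ne', hΓs]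
    field_simp
  · refine tsum_congr fun n ↦ ?_
    have hs : (0 : ℝ) < n + ν + 2 := by positivity
    have hΓ : Real.Gamma (n + ν + 2) ≠ 0 := (Real.Gamma_pos_of_pos hs).ne'
    have e1 : Real.Gamma (((n + 1 : ℕ) : ℝ) + ν + 1) = Real.Gamma (n + ν + 2) := by
      congr 1; push_cast; ring
    have e2 : Real.Gamma (((n + 1 : ℕ) : ℝ) + (ν + 1) + 1)
        = (n + ν + 2) * Real.Gamma (n + ν + 2) := by
      rw [← Real.Gamma_add_one hs.ne']; congr 1; push_cast; ring
    have e3 : Real.Gamma ((n : ℝ) + (ν + 2) + 1) = (n + ν + 2) * Real.Gamma (n + ν + 2) := by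
      rw [← Real.Gamma_add_one hs.ne']; congr 1; ring
    have p1 : (x / 2) ^ (2 * ((n + 1 : ℕ) : ℝ) + ν) = (x / 2) ^ (2 * (n : ℝ) + (ν + 2)) := by
      congr 1; push_cast; ring
    have p2 : (x / 2) ^ (2 * ((n + 1 : ℕ) : ℝ) + (ν + 1))
        = (x / 2) ^ (2 * (n : ℝ) + (ν + 2)) * (x / 2) := by
      rw [← Real.rpow_add_one hx2.ne']; congr 1; push_cast; ring
    rw [e1, e2, e3, p1, p2, Nat.factorial_succ]
    push_cast
    field_simp
    ring

theorem Real.sq_div_four_le_cosh (t : ℝ) : t ^ 2 / 4 ≤ Real.cosh t := by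
  have h := Real.quadratic_le_exp_of_nonneg (abs_nonneg t)
  rw [sq_abs] at h
  rw [← Real.cosh_abs, Real.cosh_eq]
  linarith [abs_nonneg t, Real.exp_pos (-|t|)]

theorem integrable_exp_mul_sub_mul_cosh {x : ℝ} (hx : 0 < x) (ν : ℝ) :
    Integrable fun t : ℝ ↦ Real.exp (ν * t - x * Real.cosh t) := by
  refine ((integrable_exp_neg_mul_sq (b := x / 8) (by positivity)).const_mul
    (Real.exp (2 * ν ^ 2 / x))).mono' (by fun_prop) (ae_of_all _ fun t ↦ ?_)
  rw [Real.norm_eq_abs, abs_of_pos (Real.exp_pos _), ← Real.exp_add, Real.exp_le_exp]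
  have hcosh := mul_le_mul_of_nonneg_left (Real.sq_div_four_le_cosh t) hx.le
  have hsq : 2 * ν ^ 2 / x + x / 8 * t ^ 2 - ν * t = (x * t - 4 * ν) ^ 2 / (8 * x) := by
    field_simp
    ring
  have : 0 ≤ (x * t - 4 * ν) ^ 2 / (8 * x) := by positivity
  linarith

theorem besselK_eq_half_integral {x : ℝ} (hx : 0 < x) (ν : ℝ) :
    besselK ν x = (∫ t : ℝ, Real.exp (ν * t - x * Real.cosh t)) / 2 := by
  have hint := integrable_exp_mul_sub_mul_cosh hx ν
  have hneg : ∫ t in Iic (0 : ℝ), Real.exp (ν * t - x * Real.cosh t)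
      = ∫ t in Ioi (0 : ℝ), Real.exp (-ν * t - x * Real.cosh t) := by
    have := integral_comp_neg_Ioi (0 : ℝ) fun t ↦ Real.exp (ν * t - x * Real.cosh t)
    simpa using this.symm
  rw [← intervalIntegral.integral_Iic_add_Ioi (b := 0) hint.integrableOn hint.integrableOn, hneg,
    ← integral_add (integrable_exp_mul_sub_mul_cosh hx (-ν)).integrableOn hint.integrableOn,
    ← integral_div]
  refine integral_congr_ae (ae_of_all _ fun t ↦ ?_)
  simp only [Real.cosh_eq (ν * t), sub_eq_add_neg, Real.exp_add, neg_mul]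
  ring

theorem besselK_nonneg {x : ℝ} (hx : 0 < x) (ν : ℝ) : 0 ≤ besselK ν x := by
  rw [besselK_eq_half_integral hx]
  positivity

theorem besselK_recurrence {x : ℝ} (hx : 0 < x) (ν : ℝ) :
    besselK (ν + 1) x = 2 * ν / x * besselK ν x + besselK (ν - 1) x := by
  have h0 := integrable_exp_mul_sub_mul_cosh hx ν
  have h1 := integrable_exp_mul_sub_mul_cosh hx (ν + 1)
  have h2 := integrable_exp_mul_sub_mul_cosh hx (ν - 1)
  have h12 : Integrable fun t : ℝ ↦ x / 2 * Real.exp ((ν + 1) * t - x * Real.cosh t)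
      - x / 2 * Real.exp ((ν - 1) * t - x * Real.cosh t) :=
    (h1.const_mul (x / 2)).sub (h2.const_mul (x / 2))
  have hderiv : ∀ t : ℝ, HasDerivAt (fun t ↦ Real.exp (ν * t - x * Real.cosh t))
      (ν * Real.exp (ν * t - x * Real.cosh t)
        - (x / 2 * Real.exp ((ν + 1) * t - x * Real.cosh t)
          - x / 2 * Real.exp ((ν - 1) * t - x * Real.cosh t))) t := by
    intro t
    have h := (((hasDerivAt_id t).const_mul ν).sub
      ((Real.hasDerivAt_cosh t).const_mul x)).exp
    convert! h using 1
    simp only [Pi.sub_apply, id]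
    rw [show (ν + 1) * t - x * Real.cosh t = ν * t - x * Real.cosh t + t by ring,
      show (ν - 1) * t - x * Real.cosh t = ν * t - x * Real.cosh t + -t by ring,
      Real.exp_add, Real.exp_add _ (-t), Real.sinh_eq]
    ring
  have hzero := integral_eq_zero_of_hasDerivAt_of_integrable hderiv
    ((h0.const_mul ν).sub h12) h0
  rw [integral_sub (h0.const_mul ν) h12,
    integral_sub (h1.const_mul (x / 2)) (h2.const_mul (x / 2)), integral_const_mul,
    integral_const_mul, integral_const_mul] at hzero
  simp only [besselK_eq_half_integral hx]
  field_simp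
  linarith

theorem exp_smul_rpow_mul_exp_neg (ν c t : ℝ) :
    |Real.exp t| • ((Real.exp t) ^ (ν - 1) * Real.exp (-(c * Real.exp t)))
      = Real.exp (ν * t - c * Real.exp t) := by
  rw [abs_of_pos (Real.exp_pos t), smul_eq_mul, ← Real.exp_mul, ← Real.exp_add, ← Real.exp_add]
  congr 1
  ring

theorem integrable_exp_mul_sub_mul_exp {ν c : ℝ} (hν : 0 < ν) (hc : 0 < c) :
    Integrable fun t : ℝ ↦ Real.exp (ν * t - c * Real.exp t) := by
  have h := integrableOn_image_iff_integrableOn_abs_deriv_smul MeasurableSet.univ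
    (fun t _ ↦ (Real.hasDerivAt_exp t).hasDerivWithinAt) Real.exp_injective.injOn
    fun s : ℝ ↦ s ^ (ν - 1) * Real.exp (-(c * s))
  simp only [image_univ, Real.range_exp, exp_smul_rpow_mul_exp_neg, integrableOn_univ] at h
  refine h.1 ?_
  simpa using integrableOn_rpow_mul_exp_neg_mul_rpow (s := ν - 1) (by linarith) one_pos hc

theorem integral_exp_mul_sub_mul_exp {ν c : ℝ} (hν : 0 < ν) (hc : 0 < c) :
    ∫ t : ℝ, Real.exp (ν * t - c * Real.exp t) = (1 / c) ^ ν * Real.Gamma ν := by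
  have h := integral_image_eq_integral_abs_deriv_smul MeasurableSet.univ
    (fun t _ ↦ (Real.hasDerivAt_exp t).hasDerivWithinAt) Real.exp_injective.injOn
    fun s : ℝ ↦ s ^ (ν - 1) * Real.exp (-(c * s))
  simp only [image_univ, Real.range_exp, exp_smul_rpow_mul_exp_neg, setIntegral_univ] at h
  rw [← h, Real.integral_rpow_mul_exp_neg_mul_Ioi hν hc]

theorem le_besselK_add_one {ν x : ℝ} (hν : 0 < ν) (hx : 0 < x) :
    (2 / x) ^ (ν + 1) * Real.Gamma (ν + 1) / 2 * (1 - x ^ 2 / (4 * ν)) ≤ besselK (ν + 1) x := by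
  have hx2 : 0 < x / 2 := by positivity
  have h1 := integrable_exp_mul_sub_mul_exp (ν := ν + 1) (by positivity) hx2
  have h0 := (integrable_exp_mul_sub_mul_exp hν hx2).const_mul (x / 2)
  have hle := integral_mono (h1.sub h0) (integrable_exp_mul_sub_mul_cosh hx (ν + 1)) fun t ↦ by
    have hsplit : (ν + 1) * t - x * Real.cosh t
        = (ν + 1) * t - x / 2 * Real.exp t + -(x / 2 * Real.exp (-t)) := by
      rw [Real.cosh_eq]; ring
    have hshift : Real.exp (ν * t - x / 2 * Real.exp t)
        = Real.exp ((ν + 1) * t - x / 2 * Real.exp t) * Real.exp (-t) := by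
      rw [← Real.exp_add]; congr 1; ring
    have hlin := Real.add_one_le_exp (-(x / 2 * Real.exp (-t)))
    simp only [Pi.sub_apply]
    rw [hsplit, Real.exp_add _ (-(x / 2 * Real.exp (-t))), hshift]
    nlinarith [Real.exp_pos ((ν + 1) * t - x / 2 * Real.exp t)]
  simp only [Pi.sub_apply] at hle
  rw [integral_sub h1 h0, integral_const_mul, integral_exp_mul_sub_mul_exp (by positivity) hx2,
    integral_exp_mul_sub_mul_exp hν hx2, one_div_div] at hle
  rw [besselK_eq_half_integral hx]
  refine le_trans (le_of_eq ?_) (div_le_div_of_nonneg_right hle two_pos.le)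
  rw [Real.rpow_add_one (by positivity), Real.Gamma_add_one hν.ne']
  field_simp
  ring

theorem besselI_besselK_wronskian_add_one {ν x : ℝ} (hν : 0 ≤ ν) (hx : 0 < x) :
    besselI (ν + 1 + 1) x * besselK (ν + 1) x + besselI (ν + 1) x * besselK (ν + 1 + 1) x
      = besselI (ν + 1) x * besselK ν x + besselI ν x * besselK (ν + 1) x := by
  rw [besselI_recurrence hν hx, besselK_recurrence hx (ν + 1), add_sub_cancel_right,
    show ν + 1 + 1 = ν + 2 by ring]
  ring

theorem besselI_besselK_wronskian_add_nat {ν x : ℝ} (hν : 0 ≤ ν) (hx : 0 < x) (n : ℕ) :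
    besselI (ν + n + 1) x * besselK (ν + n) x + besselI (ν + n) x * besselK (ν + n + 1) x
      = besselI (ν + 1) x * besselK ν x + besselI ν x * besselK (ν + 1) x := by
  induction n with
  | zero => simp
  | succ n ih =>
    rw [← ih, ← besselI_besselK_wronskian_add_one (ν := ν + n) (by positivity) hx]
    push_cast
    simp only [add_assoc]

theorem one_sub_le_mul_besselI_mul_besselK_add_one {ν x : ℝ} (hν : 0 < ν) (hx : 0 < x)
    (hνx : x ^ 2 ≤ 4 * ν) :
    1 - x ^ 2 / (4 * ν) ≤ x * (besselI ν x * besselK (ν + 1) x) := by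
  have hΓ : 0 < Real.Gamma (ν + 1) := Real.Gamma_pos_of_pos (by positivity)
  have hnonneg : 0 ≤ 1 - x ^ 2 / (4 * ν) := by
    rw [sub_nonneg, div_le_one (by positivity)]
    exact hνx
  have hpow : (x / 2) ^ ν * (2 / x) ^ (ν + 1) = 2 / x := by
    rw [Real.rpow_add_one (by positivity), ← mul_assoc, ← Real.mul_rpow (by positivity)
      (by positivity), show x / 2 * (2 / x) = 1 by field_simp, Real.one_rpow, one_mul]
  calc 1 - x ^ 2 / (4 * ν)
      = x * ((x / 2) ^ ν * (2 / x) ^ (ν + 1)) / 2 * (1 - x ^ 2 / (4 * ν)) := by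
        rw [hpow]; field_simp
    _ = x * ((x / 2) ^ ν / Real.Gamma (ν + 1)
        * ((2 / x) ^ (ν + 1) * Real.Gamma (ν + 1) / 2 * (1 - x ^ 2 / (4 * ν)))) := by
        field_simp
    _ ≤ x * (besselI ν x * besselK (ν + 1) x) := by
        gcongr
        · exact besselI_nonneg hν.le hx.le
        · exact rpow_div_Gamma_le_besselI hν.le hx
        · exact le_besselK_add_one hν hx

/-- One half of the Wronskian identity `x (I_{ν+1} K_ν + I_ν K_{ν+1}) = 1`. -/
theorem one_le_mul_besselI_besselK_wronskian {ν x : ℝ} (hν : 0 < ν) (hx : 0 < x) :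
    1 ≤ x * (besselI (ν + 1) x * besselK ν x + besselI ν x * besselK (ν + 1) x) := by
  have hlim : Tendsto (fun n : ℕ ↦ 1 - x ^ 2 / (4 * (ν + n))) atTop (𝓝 1) := by
    have hden : Tendsto (fun n : ℕ ↦ 4 * (ν + n)) atTop atTop :=
      (tendsto_atTop_add_const_left _ ν tendsto_natCast_atTop_atTop).const_mul_atTop (by norm_num)
    simpa using (hden.const_div_atTop (x ^ 2)).const_sub 1
  refine le_of_tendsto hlim ?_
  filter_upwards [tendsto_natCast_atTop_atTop.eventually_ge_atTop (x ^ 2)] with n hn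
  rw [← besselI_besselK_wronskian_add_nat hν.le hx n]
  refine (one_sub_le_mul_besselI_mul_besselK_add_one (by positivity) hx
    (by nlinarith)).trans ?_
  gcongr
  exact le_add_of_nonneg_left
    (mul_nonneg (besselI_nonneg (by positivity) hx.le) (besselK_nonneg hx _))

theorem besselI_add_one_le {ν x : ℝ} (hν : 0 ≤ ν) (hx : 0 < x) :
    besselI (ν + 1) x ≤ x / (2 * (ν + 1)) * besselI ν x := by
  have hI := besselI_nonneg (ν := ν + 2) (by positivity) hx.le
  rw [besselI_recurrence hν hx, mul_add, ← mul_assoc,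
    show x / (2 * (ν + 1)) * (2 * (ν + 1) / x) = 1 by field_simp, one_mul]
  exact le_add_of_nonneg_right (by positivity)

theorem besselK_sub_one_le {ν x : ℝ} (hν : 1 < ν) (hx : 0 < x) :
    besselK (ν - 1) x ≤ x / (2 * (ν - 1)) * besselK ν x := by
  have hν1 : 0 < ν - 1 := by linarith
  have hK := besselK_nonneg hx (ν - 1 - 1)
  have hrec := besselK_recurrence hx (ν - 1)
  rw [sub_add_cancel] at hrec
  rw [hrec, mul_add, ← mul_assoc,
    show x / (2 * (ν - 1)) * (2 * (ν - 1) / x) = 1 by field_simp, one_mul]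
  exact le_add_of_nonneg_right (by positivity)

theorem stmt5 (ν x : ℝ) (hν : 1 < ν) (hx : 0 < x) :
    besselI ν x * besselK ν x ≥ 1 / (2 * ν) - x ^ 2 / (4 * ν * (ν ^ 2 - 1)) := by
  have hν0 : 0 < ν := by linarith
  have hν1 : 0 < ν - 1 := by linarith
  have hν2 : 0 < ν ^ 2 - 1 := by nlinarith
  have hI0 := besselI_nonneg hν0.le hx.le
  have hK0 := besselK_nonneg hx ν
  have hI := mul_le_mul_of_nonneg_right (besselI_add_one_le hν0.le hx) hK0
  have hK := mul_le_mul_of_nonneg_left (besselK_sub_one_le hν hx) hI0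
  have hW := one_le_mul_besselI_besselK_wronskian hν0 hx
  rw [besselK_recurrence hx ν] at hW
  set p := besselI ν x * besselK ν x with hp
  set q := x ^ 2 / (2 * (ν ^ 2 - 1)) with hq
  have hq0 : 0 ≤ q := by positivity
  have hbound : 1 ≤ 2 * ν * p * (1 + q) := by
    calc 1 ≤ x * (x / (2 * (ν + 1)) * besselI ν x * besselK ν x
          + (2 * ν / x * p + besselI ν x * (x / (2 * (ν - 1)) * besselK ν x))) := by
          refine hW.trans (mul_le_mul_of_nonneg_left ?_ hx.le)
          rw [mul_add]
          linarith
      _ = 2 * ν * p * (1 + q) := by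
          rw [hp, hq, show ν ^ 2 - 1 = (ν - 1) * (ν + 1) by ring]
          field_simp
          ring
  have hlin : 1 - q ≤ 2 * ν * p := by
    by_contra! h
    nlinarith
  have heq : 1 / (2 * ν) - x ^ 2 / (4 * ν * (ν ^ 2 - 1)) = (1 - q) / (2 * ν) := by
    rw [hq]
    field_simp
    ring
  rw [ge_iff_le, heq, div_le_iff₀ (by positivity)]
  linarith
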